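/- With the setup of the previous statement (Y ≥ 0, E[Y]=1, E[Y²]<∞, m = E[Y²]/2, a_T = 1−λ/T, ρ^T(z) = (T(1−a_T)/a_T) ψ^T(Tz)), the random variables Z^T with density ρ^T converge weakly as T → ∞ to an exponential random variable with density (λ/m) exp(−λx/m). -/

import Mathlib

open MeasureTheory Filter

/-- Iterated convolution on `[0,∞)`: `iterConv φ k = φ^{*(k+1)}`. -/
noncomputable def iterConv (φ : ℝ → ℝ) : ℕ → ℝ → ℝ
  | 0 => φ
  | (k+1) => fun t => ∫ s in (0:ℝ)..t, φ (t - s) * iterConv φ k s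

/-- The rescaled renewal density `ρ^T(z) = (T(1-a_T)/a_T) ψ^T(Tz)` with
`a_T = 1 - λ/T` and `φ^T(z) = a_T P(Y > z)`. -/
noncomputable def rhoT {Ω : Type*} [MeasurableSpace Ω] (μ : Measure Ω) (Y : Ω → ℝ)
    (lam T z : ℝ) : ℝ :=
  (T * (1 - (1 - lam / T)) / (1 - lam / T)) *
    (∑' k : ℕ, iterConv (fun w => (1 - lam / T) * (μ {ω | w < Y ω}).toReal) k (T * z))

open Set Topology

/-- `h` is a probability density on `(0,∞)`. -/
structure IsPosDensity (h : ℝ → ℝ) : Prop where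
  nonneg : ∀ x, 0 < x → 0 ≤ h x
  integrableOn : IntegrableOn h (Ioi 0)
  integral_eq_one : ∫ x in Ioi 0, h x = 1

/-- The measure on `(0,∞)` with density `h`. -/
noncomputable def posMeasure (h : ℝ → ℝ) : Measure ℝ :=
  (volume.restrict (Ioi 0)).withDensity fun x => ENNReal.ofReal (h x)

/-- The Fourier transform of a function on `(0,∞)`, with the sign convention of `charFun`. -/
noncomputable def posFourier (h : ℝ → ℝ) (s : ℝ) : ℂ :=
  ∫ x : ℝ in Ioi 0, Complex.exp (s * x * Complex.I) * h x

theorem integrableOn_exp_mul_ofReal {h : ℝ → ℝ} (hh : IntegrableOn h (Ioi 0)) (s : ℝ) :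
    IntegrableOn (fun x : ℝ => Complex.exp (s * x * Complex.I) * (h x : ℂ)) (Ioi 0) := by
  refine Integrable.bdd_mul (c := 1) hh.ofReal (by fun_prop) (ae_of_all _ fun x => ?_)
  rw [← Complex.ofReal_mul, Complex.norm_exp_ofReal_mul_I]

namespace IsPosDensity

variable {h : ℝ → ℝ}

theorem ae_nonneg (hh : IsPosDensity h) : 0 ≤ᵐ[volume.restrict (Ioi 0)] h :=
  (ae_restrict_mem measurableSet_Ioi).mono fun x hx => hh.nonneg x hx

theorem isProbabilityMeasure (hh : IsPosDensity h) : IsProbabilityMeasure (posMeasure h) := by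
  refine ⟨?_⟩
  rw [posMeasure, withDensity_apply _ MeasurableSet.univ, setLIntegral_univ,
    ← ofReal_integral_eq_lintegral_ofReal hh.integrableOn hh.ae_nonneg, hh.integral_eq_one,
    ENNReal.ofReal_one]

theorem charFun_posMeasure (hh : IsPosDensity h) (s : ℝ) :
    charFun (posMeasure h) s = posFourier h s := by
  rw [charFun_apply_real, posMeasure, integral_withDensity_eq_integral_toReal_smul₀
    hh.integrableOn.aestronglyMeasurable.aemeasurable.ennreal_ofReal (by simp)]
  refine setIntegral_congr_fun measurableSet_Ioi fun x hx => ?_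
  simp only [ENNReal.toReal_ofReal (hh.nonneg x hx), Complex.real_smul]
  ring

theorem posMeasure_Iic (hh : IsPosDensity h) (x : ℝ) :
    (posMeasure h (Iic x)).toReal = ∫ z in Ioc 0 x, h z := by
  rw [posMeasure, withDensity_apply _ measurableSet_Iic,
    Measure.restrict_restrict measurableSet_Iic,
    inter_comm, Ioi_inter_Iic, integral_eq_lintegral_of_nonneg_ae]
  · exact ae_restrict_of_ae_restrict_of_subset Ioc_subset_Ioi_self hh.ae_nonneg
  · exact (hh.integrableOn.mono_set Ioc_subset_Ioi_self).aestronglyMeasurable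

/-- Lévy's continuity theorem for densities on `(0,∞)`. -/
theorem tendsto_integral_Ioc {f : ℕ → ℝ → ℝ} (hf : ∀ n, IsPosDensity (f n))
    (hh : IsPosDensity h)
    (hlim : ∀ s, Tendsto (fun n => posFourier (f n) s) atTop (𝓝 (posFourier h s))) (x : ℝ) :
    Tendsto (fun n => ∫ z in Ioc 0 x, f n z) atTop (𝓝 (∫ z in Ioc 0 x, h z)) := by
  let P : ℕ → ProbabilityMeasure ℝ := fun n => ⟨posMeasure (f n), (hf n).isProbabilityMeasure⟩
  let Q : ProbabilityMeasure ℝ := ⟨posMeasure h, hh.isProbabilityMeasure⟩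
  have hPQ : Tendsto P atTop (𝓝 Q) := by
    refine ProbabilityMeasure.tendsto_of_tendsto_charFun fun s => ?_
    simpa [P, Q, (hf _).charFun_posMeasure, hh.charFun_posMeasure] using hlim s
  have hfr : (Q : Measure ℝ) (frontier (Iic x)) = 0 := by
    rw [frontier_Iic]
    exact (withDensity_absolutelyContinuous _ _)
      (Measure.absolutelyContinuous_of_le Measure.restrict_le_self (by simp))
  have key := (ENNReal.tendsto_toReal (measure_ne_top (Q : Measure ℝ) (Iic x))).comp
    (ProbabilityMeasure.tendsto_measure_of_null_frontier_of_tendsto' hPQ hfr)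
  have e : ∀ n, ((P n : Measure ℝ) (Iic x)).toReal = ∫ z in Ioc 0 x, f n z :=
    fun n => (hf n).posMeasure_Iic x
  have e' : ((Q : Measure ℝ) (Iic x)).toReal = ∫ z in Ioc 0 x, h z := hh.posMeasure_Iic x
  rw [← e']
  simpa only [Function.comp_def, e] using key

end IsPosDensity

theorem posFourier_mul_exp {r : ℝ} (hr : 0 < r) (s : ℝ) :
    posFourier (fun x => r * Real.exp (-r * x)) s = r / (r - s * Complex.I) := by
  have hre : (s * Complex.I - r : ℂ).re < 0 := by simpa using hr
  have hne : (s * Complex.I - r : ℂ) ≠ 0 := fun h => by simp [h] at hre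
  have e : ∀ x : ℝ, Complex.exp (s * x * Complex.I) * ((r * Real.exp (-r * x) : ℝ) : ℂ)
      = r * Complex.exp ((s * Complex.I - r) * x) := fun x => by
    push_cast
    rw [mul_left_comm, ← Complex.exp_add]
    ring_nf
  rw [posFourier]
  simp_rw [e]
  rw [integral_const_mul, integral_exp_mul_complex_Ioi hre]
  have hne' : (r - s * Complex.I : ℂ) ≠ 0 := fun h => hne (by linear_combination -h)
  simp only [Complex.ofReal_zero, mul_zero, Complex.exp_zero]
  field_simp
  ring

theorem isPosDensity_mul_exp {r : ℝ} (hr : 0 < r) :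
    IsPosDensity fun x => r * Real.exp (-r * x) where
  nonneg x _ := by positivity
  integrableOn := (integrableOn_exp_mul_Ioi (by linarith) 0).const_mul r
  integral_eq_one := by
    rw [integral_const_mul, integral_exp_mul_Ioi (by linarith)]
    simp [hr.ne']

section Renewal

variable {f : ℝ → ℝ}

theorem iterConv_nonneg (hf : ∀ x, 0 ≤ f x) (k : ℕ) {t : ℝ} (ht : 0 ≤ t) :
    0 ≤ iterConv f k t := by
  induction k generalizing t with
  | zero => exact hf t
  | succ k ih =>
    exact intervalIntegral.integral_nonneg ht fun s hs => mul_nonneg (hf _) (ih hs.1)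

theorem integrableOn_iterConv (hf : IntegrableOn f (Ioi 0)) (k : ℕ) :
    IntegrableOn (iterConv f k) (Ioi 0) := by
  induction k with
  | zero => exact hf
  | succ k ih =>
    refine (integrable_posConvolution ih hf (ContinuousLinearMap.mul ℝ ℝ)).integrableOn.congr_fun
      (fun x hx => ?_) measurableSet_Ioi
    rw [posConvolution, indicator_of_mem hx]
    simp [iterConv, mul_comm]

theorem posFourier_iterConv (hf : IntegrableOn f (Ioi 0)) (k : ℕ) (s : ℝ) :
    posFourier (iterConv f k) s = posFourier f s ^ (k + 1) := by
  induction k with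
  | zero => simp [iterConv]
  | succ k ih =>
    rw [pow_succ, ← ih]
    unfold posFourier
    have := integral_posConvolution
      (integrableOn_exp_mul_ofReal (integrableOn_iterConv hf k) s)
      (integrableOn_exp_mul_ofReal hf s) (ContinuousLinearMap.mul ℝ ℂ)
    simp only [ContinuousLinearMap.mul_apply'] at this
    rw [← this]
    congr 1 with x
    rw [iterConv, ← intervalIntegral.integral_ofReal, ← intervalIntegral.integral_const_mul]
    congr 1 with t
    have : Complex.exp (s * x * Complex.I) = Complex.exp (s * t * Complex.I) *
        Complex.exp (s * (x - t : ℝ) * Complex.I) := by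
      rw [← Complex.exp_add]
      push_cast
      ring_nf
    rw [this]
    push_cast
    ring

theorem posFourier_zero (h : ℝ → ℝ) : posFourier h 0 = ((∫ x in Ioi 0, h x : ℝ) : ℂ) := by
  simp [posFourier, integral_complex_ofReal]

theorem integral_iterConv (hf : IntegrableOn f (Ioi 0)) (k : ℕ) :
    ∫ x in Ioi 0, iterConv f k x = (∫ x in Ioi 0, f x) ^ (k + 1) := by
  have := posFourier_iterConv hf k 0
  rw [posFourier_zero, posFourier_zero] at this
  exact_mod_cast this

theorem norm_posFourier_le (hf0 : ∀ x, 0 ≤ f x) (s : ℝ) : ‖posFourier f s‖ ≤ ∫ x in Ioi 0, f x := by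
  refine (norm_integral_le_integral_norm _).trans_eq ?_
  congr 1 with x
  rw [norm_mul, ← Complex.ofReal_mul, Complex.norm_exp_ofReal_mul_I, one_mul, Complex.norm_real,
    Real.norm_of_nonneg (hf0 x)]

theorem posFourier_tsum_iterConv (hf0 : ∀ x, 0 ≤ f x) (hf : IntegrableOn f (Ioi 0))
    (hf1 : ∫ x in Ioi 0, f x < 1) (s : ℝ) :
    posFourier (fun t => ∑' k, iterConv f k t) s = posFourier f s / (1 - posFourier f s) := by
  have hF := hasSum_integral_of_summable_integral_norm
    (fun k => integrableOn_exp_mul_ofReal (integrableOn_iterConv hf k) s) (by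
      have e : ∀ k, ∫ x : ℝ in Ioi 0, ‖Complex.exp (s * x * Complex.I) * (iterConv f k x : ℂ)‖
          = (∫ x in Ioi 0, f x) * (∫ x in Ioi 0, f x) ^ k := fun k => by
        rw [← pow_succ', ← integral_iterConv hf]
        refine setIntegral_congr_fun measurableSet_Ioi fun x hx => ?_
        simp only [norm_mul]
        rw [← Complex.ofReal_mul, Complex.norm_exp_ofReal_mul_I, one_mul,
          Complex.norm_real, Real.norm_of_nonneg (iterConv_nonneg hf0 k (le_of_lt hx))]
      simp_rw [e]
      exact (summable_geometric_of_lt_one (integral_nonneg hf0) hf1).mul_left _)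
  have hG : HasSum (fun k => posFourier f s ^ (k + 1)) (posFourier f s / (1 - posFourier f s)) := by
    simp_rw [pow_succ', div_eq_mul_inv]
    exact (hasSum_geometric_of_norm_lt_one
      ((norm_posFourier_le hf0 s).trans_lt hf1)).mul_left _
  simp_rw [← posFourier_iterConv hf] at hG
  rw [← hF.unique hG, posFourier]
  simp_rw [Complex.ofReal_tsum, tsum_mul_left]

end Renewal

theorem posFourier_comp_mul_left (h : ℝ → ℝ) {T : ℝ} (hT : 0 < T) (c s : ℝ) :
    posFourier (fun z => c * h (T * z)) s = c / T * posFourier h (s / T) := by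
  have := integral_comp_mul_left_Ioi
    (fun x : ℝ => Complex.exp ((s / T : ℝ) * x * Complex.I) * (h x : ℂ)) 0 hT
  rw [mul_zero] at this
  have e : ∀ z : ℝ, Complex.exp (s * z * Complex.I) * ((c * h (T * z) : ℝ) : ℂ)
      = c * (Complex.exp ((s / T : ℝ) * (T * z : ℝ) * Complex.I) * (h (T * z) : ℂ)) := fun z => by
    have : (T : ℂ) ≠ 0 := by exact_mod_cast hT.ne'
    have e' : ((s / T : ℝ) : ℂ) * (T * z : ℝ) = s * z := by push_cast; field_simp
    rw [e']
    push_cast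
    ring
  unfold posFourier
  simp_rw [e]
  rw [integral_const_mul, this, Complex.real_smul]
  push_cast
  ring

theorem tendsto_mul_one_sub_posFourier {φ : ℝ → ℝ} (hφ : IsPosDensity φ)
    (hφ1 : IntegrableOn (fun t => t * φ t) (Ioi 0)) (s : ℝ) :
    Tendsto (fun T : ℝ => T * (1 - posFourier φ (s / T))) atTop
      (𝓝 (-(s * (∫ t in Ioi 0, t * φ t : ℝ) * Complex.I))) := by
  have e : ∀ T : ℝ, T * (1 - posFourier φ (s / T)) =
      ∫ t : ℝ in Ioi 0, T * (1 - Complex.exp ((s / T : ℝ) * t * Complex.I)) * (φ t : ℂ) := fun T => by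
    have h1 : (1 : ℂ) = ∫ t in Ioi 0, (φ t : ℂ) := by
      rw [integral_complex_ofReal, hφ.integral_eq_one, Complex.ofReal_one]
    have h2 := integral_sub hφ.integrableOn.ofReal
      (integrableOn_exp_mul_ofReal hφ.integrableOn (s / T))
    simp only [Complex.coe_algebraMap, ← h1] at h2
    rw [posFourier, ← h2, ← integral_const_mul]
    congr 1 with t
    ring
  have e2 : (-(s * (∫ t in Ioi 0, t * φ t : ℝ) * Complex.I)) =
      ∫ t : ℝ in Ioi 0, (-(s * t * Complex.I)) * (φ t : ℂ) := by
    rw [← integral_complex_ofReal]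
    rw [← integral_const_mul, ← integral_mul_const, ← integral_neg]
    congr 1 with t
    push_cast
    ring
  simp_rw [e, e2]
  refine tendsto_integral_filter_of_dominated_convergence (fun t => |s| * (t * φ t))
    (Eventually.of_forall fun T => ?_) ?_ (hφ1.const_mul _) (ae_of_all _ fun t => ?_)
  · exact AEStronglyMeasurable.mul (by fun_prop) hφ.integrableOn.ofReal.aestronglyMeasurable
  · filter_upwards [eventually_gt_atTop 0] with T hT
    filter_upwards [ae_restrict_mem measurableSet_Ioi] with t ht
    have hb := Real.norm_exp_I_mul_ofReal_sub_one_le (x := s / T * t)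
    rw [norm_mul, norm_mul, norm_sub_rev, Complex.norm_real, Complex.norm_real,
      Real.norm_of_nonneg (hφ.nonneg t ht), Real.norm_of_nonneg hT.le, ← mul_assoc,
      ← Complex.ofReal_mul, mul_comm _ Complex.I]
    refine mul_le_mul_of_nonneg_right ?_ (hφ.nonneg t ht)
    calc _ ≤ T * ‖s / T * t‖ := mul_le_mul_of_nonneg_left hb hT.le
      _ = |s| * t := by
        rw [Real.norm_eq_abs, abs_mul, abs_div, abs_of_pos hT, abs_of_pos (mem_Ioi.1 ht)]
        field_simp
  · refine Tendsto.mul_const _ ?_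
    have hd : HasDerivAt (fun u : ℝ => Complex.exp (s * u * t * Complex.I))
        (s * t * Complex.I) 0 := by
      have h1 : HasDerivAt (fun u : ℂ => Complex.exp (s * u * t * Complex.I))
          (s * t * Complex.I) ((0 : ℝ) : ℂ) := by
        have := ((((hasDerivAt_id ((0 : ℝ) : ℂ)).const_mul (s : ℂ)).mul_const
          (t : ℂ)).mul_const Complex.I).cexp
        simpa using this
      exact h1.comp_ofReal
    have h2 := (hd.tendsto_slope_zero_right.comp tendsto_inv_atTop_nhdsGT_zero).neg
    refine h2.congr fun T => ?_
    simp [div_eq_mul_inv]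
    ring

section Tail

variable {Ω : Type*} [MeasurableSpace Ω] {μ : Measure Ω} {Y : Ω → ℝ}

theorem isPosDensity_tail (hY0 : 0 ≤ᵐ[μ] Y) (hEY : ∫ ω, Y ω ∂μ = 1) :
    IsPosDensity fun w => (μ {ω | w < Y ω}).toReal := by
  have hint : Integrable Y μ := by
    by_contra h
    simp [integral_undef h] at hEY
  have h1 : ∫ w in Ioi (0 : ℝ), (μ {ω | w < Y ω}).toReal = 1 := by
    rw [← hEY]
    exact (hint.integral_eq_integral_meas_lt hY0).symm
  refine ⟨fun _ _ => ENNReal.toReal_nonneg, ?_, h1⟩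
  by_contra h
  simp [integral_undef h] at h1

theorem integral_mul_tail [IsFiniteMeasure μ] (hY : AEMeasurable Y μ) (hY0 : 0 ≤ᵐ[μ] Y) :
    ∫ t in Ioi (0 : ℝ), t * (μ {ω | t < Y ω}).toReal = (∫ ω, Y ω ^ 2 ∂μ) / 2 := by
  have hmeas : Measurable fun t : ℝ => (μ {ω | t < Y ω}).toReal :=
    Antitone.measurable fun a b hab =>
      ENNReal.toReal_mono (measure_ne_top _ _) (measure_mono fun ω hω => lt_of_le_of_lt hab hω)
  have key := lintegral_rpow_eq_lintegral_meas_lt_mul μ hY0 hY two_pos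
  rw [integral_eq_lintegral_of_nonneg_ae, integral_eq_lintegral_of_nonneg_ae
    (ae_of_all _ fun _ => sq_nonneg _) (hY.pow_const 2).aestronglyMeasurable]
  · simp only [Real.rpow_two] at key
    rw [key, ENNReal.toReal_mul, ENNReal.toReal_ofReal two_pos.le,
      mul_div_cancel_left₀ _ two_ne_zero]
    congr 1
    refine setLIntegral_congr_fun measurableSet_Ioi fun t ht => ?_
    norm_num
    rw [ENNReal.ofReal_mul (le_of_lt ht), ENNReal.ofReal_toReal (measure_ne_top _ _), mul_comm]
  · filter_upwards [ae_restrict_mem measurableSet_Ioi] with t ht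
    exact mul_nonneg (le_of_lt ht) ENNReal.toReal_nonneg
  · exact (measurable_id.mul hmeas).aestronglyMeasurable

end Tail

theorem posFourier_const_mul (c : ℝ) (h : ℝ → ℝ) (s : ℝ) :
    posFourier (fun x => c * h x) s = c * posFourier h s := by
  unfold posFourier
  rw [← integral_const_mul]
  congr 1 with x
  push_cast
  ring

section Rescaled

variable {φ : ℝ → ℝ} {a T : ℝ}

theorem posFourier_rescaled_renewal (hφ0 : ∀ x, 0 ≤ φ x) (hφ : IsPosDensity φ) (ha : 0 < a)
    (ha1 : a < 1) (hT : 0 < T) (s : ℝ) :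
    posFourier (fun z => T * (1 - a) / a * ∑' k, iterConv (fun w => a * φ w) k (T * z)) s =
      T * (1 - a) * posFourier φ (s / T) /
        (T * (1 - posFourier φ (s / T)) + T * (1 - a) * posFourier φ (s / T)) := by
  have hT' : (T : ℂ) ≠ 0 := by exact_mod_cast hT.ne'
  have ha' : (a : ℂ) ≠ 0 := by exact_mod_cast ha.ne'
  rw [posFourier_comp_mul_left (fun t => ∑' k, iterConv (fun w => a * φ w) k t) hT,
    posFourier_tsum_iterConv (fun x => mul_nonneg ha.le (hφ0 x)) (hφ.integrableOn.const_mul a)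
      (by rwa [integral_const_mul, hφ.integral_eq_one, mul_one]), posFourier_const_mul,
    show (T * (1 - posFourier φ (s / T)) + T * (1 - a) * posFourier φ (s / T) : ℂ) =
      T * (1 - a * posFourier φ (s / T)) by ring]
  push_cast
  field_simp

theorem isPosDensity_rescaled_renewal (hφ0 : ∀ x, 0 ≤ φ x) (hφ : IsPosDensity φ) (ha : 0 < a)
    (ha1 : a < 1) (hT : 0 < T) :
    IsPosDensity fun z => T * (1 - a) / a * ∑' k, iterConv (fun w => a * φ w) k (T * z) := by
  have h1 : ∫ z in Ioi 0, T * (1 - a) / a * ∑' k, iterConv (fun w => a * φ w) k (T * z) = 1 := by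
    have := posFourier_rescaled_renewal hφ0 hφ ha ha1 hT 0
    rw [zero_div, posFourier_zero, posFourier_zero, hφ.integral_eq_one] at this
    have hne : (T * (1 - a) : ℂ) ≠ 0 := by
      exact_mod_cast (mul_pos hT (sub_pos.2 ha1)).ne'
    rw [Complex.ofReal_one, sub_self, mul_zero, zero_add, mul_one, div_self hne] at this
    exact_mod_cast this
  refine ⟨fun x hx => ?_, ?_, h1⟩
  · exact mul_nonneg (div_nonneg (mul_nonneg hT.le (sub_nonneg.2 ha1.le)) ha.le)
      (tsum_nonneg fun k => iterConv_nonneg (fun x => mul_nonneg ha.le (hφ0 x)) k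
        (mul_pos hT hx).le)
  · by_contra h
    simp [integral_undef h] at h1

end Rescaled

theorem tendsto_rescaled_renewal {φ : ℝ → ℝ} (hφ0 : ∀ x, 0 ≤ φ x) (hφ : IsPosDensity φ)
    {m lam : ℝ} (hφm : ∫ t in Ioi 0, t * φ t = m) (hm : 0 < m) (hlam : 0 < lam) (x : ℝ) :
    Tendsto (fun T : ℝ => ∫ z in Ioc 0 x, T * (1 - (1 - lam / T)) / (1 - lam / T) *
        ∑' k, iterConv (fun w => (1 - lam / T) * φ w) k (T * z))
      atTop (𝓝 (∫ z in Ioc 0 x, lam / m * Real.exp (-(lam / m) * z))) := by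
  have hφ1 : IntegrableOn (fun t => t * φ t) (Ioi 0) := by
    by_contra h
    rw [integral_undef h] at hφm
    exact hm.ne hφm
  refine tendsto_of_seq_tendsto fun u hu => ?_
  have hv : Tendsto (fun n => max (u n) (2 * lam)) atTop atTop :=
    tendsto_atTop_mono (fun n => le_max_left _ _) hu
  have hev : ∀ᶠ n in atTop, max (u n) (2 * lam) = u n :=
    (hu.eventually_ge_atTop (2 * lam)).mono fun n hn => max_eq_left hn
  generalize hvdef : (fun n => max (u n) (2 * lam)) = v at hv
  have hvn : ∀ n, max (u n) (2 * lam) = v n := fun n => congrFun hvdef n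
  have hvge : ∀ n, 2 * lam ≤ v n := fun n => hvn n ▸ le_max_right _ _
  have hvpos : ∀ n, 0 < v n := fun n => by linarith [hvge n]
  have ha1 : ∀ n, 1 - lam / v n < 1 := fun n => sub_lt_self _ (div_pos hlam (hvpos n))
  have ha : ∀ n, 0 < 1 - lam / v n := fun n => by
    rw [sub_pos, div_lt_one (hvpos n)]
    linarith [hvge n]
  refine Tendsto.congr' (hev.mono fun n hn => ?_) (IsPosDensity.tendsto_integral_Ioc
    (fun n => isPosDensity_rescaled_renewal hφ0 hφ (ha n) (ha1 n) (hvpos n))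
    (isPosDensity_mul_exp (div_pos hlam hm)) (fun s => ?_) x)
  · simp only [Function.comp_apply, (hvn n).symm.trans hn]
  simp_rw [fun n => posFourier_rescaled_renewal hφ0 hφ (ha n) (ha1 n) (hvpos n) s]
  rw [posFourier_mul_exp (div_pos hlam hm)]
  have hlim := tendsto_mul_one_sub_posFourier hφ hφ1 s
  rw [hφm] at hlim
  have hone : Tendsto (fun T : ℝ => posFourier φ (s / T)) atTop (𝓝 1) := by
    have hinv : Tendsto (fun T : ℝ => ((T⁻¹ : ℝ) : ℂ)) atTop (𝓝 0) := by
      exact (Complex.continuous_ofReal.tendsto' 0 0 Complex.ofReal_zero).comp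
        tendsto_inv_atTop_zero
    have := (hinv.mul hlim).const_sub 1
    rw [zero_mul, sub_zero] at this
    refine this.congr' ((eventually_gt_atTop 0).mono fun T hT => ?_)
    have hT' : (T : ℂ) ≠ 0 := by exact_mod_cast hT.ne'
    push_cast
    field_simp
    ring
  have hTa : ∀ n, (v n : ℂ) * (1 - ((1 - lam / v n : ℝ) : ℂ)) = lam := fun n => by
    have hT' : (v n : ℂ) ≠ 0 := by exact_mod_cast (hvpos n).ne'
    push_cast
    field_simp
    ring
  simp_rw [hTa]
  have hm' : (m : ℂ) ≠ 0 := by exact_mod_cast hm.ne'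
  have hl' : (lam : ℂ) ≠ 0 := by exact_mod_cast hlam.ne'
  have hnum := (hone.comp hv).const_mul (lam : ℂ)
  have hden : (-(s * m * Complex.I) + lam * 1 : ℂ) ≠ 0 := fun h => by
    have := congrArg Complex.re h
    simp at this
    exact hlam.ne' this
  have hden' : (lam - s * m * Complex.I : ℂ) ≠ 0 := by
    rwa [mul_one, neg_add_eq_sub] at hden
  have hval : ((lam / m : ℝ) / ((lam / m : ℝ) - s * Complex.I) : ℂ)
      = lam * 1 / (-(s * m * Complex.I) + lam * 1) := by
    have h3 : ((lam / m : ℝ) - s * Complex.I : ℂ) = (lam - s * m * Complex.I) / m := by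
      push_cast
      field_simp
    rw [h3, mul_one, neg_add_eq_sub]
    push_cast
    field_simp
  rw [hval]
  exact hnum.div ((hlim.comp hv).add hnum) hden

theorem stmt6 {Ω : Type*} [MeasurableSpace Ω] (μ : Measure Ω) [IsProbabilityMeasure μ]
    (Y : Ω → ℝ) (hY : Measurable Y) (hY0 : ∀ ω, 0 ≤ Y ω)
    (hEY : ∫ ω, Y ω ∂μ = 1) (hY2 : Integrable (fun ω => (Y ω) ^ 2) μ)
    (lam m : ℝ) (hlam : 0 < lam) (hm : m = (∫ ω, (Y ω) ^ 2 ∂μ) / 2) (hm0 : 0 < m) :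
    ∀ x : ℝ, Tendsto (fun T : ℝ => ∫ z in Set.Ioc (0:ℝ) x, rhoT μ Y lam T z)
      atTop (nhds (∫ z in Set.Ioc (0:ℝ) x, lam / m * Real.exp (-lam * z / m))) := by
  intro x
  have h0 : 0 ≤ᵐ[μ] Y := ae_of_all _ hY0
  have h := tendsto_rescaled_renewal (fun _ => ENNReal.toReal_nonneg) (isPosDensity_tail h0 hEY)
    ((integral_mul_tail hY.aemeasurable h0).trans hm.symm) hm0 hlam x
  have e : ∀ z : ℝ, -lam * z / m = -(lam / m) * z := fun z => by ring
  simp_rw [e]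
  exact h
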